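/- arXiv:1507.06731 — 11 statements merged into one kernel-verified Lean document; each statement's English description precedes it below -/
import Mathlib

section
/- Let A be an m-th order n-dimensional real P-tensor. Then every H-eigenvalue of A is positive; that is, if λ ∈ ℝ and x ∈ ℝⁿ is a nonzero vector with A x^{m-1} = λ x^{[m-1]}, then λ > 0. -/
open Finset

/-- `tvec A x i` is the `i`-th component of `A x^{m-1}` for an `m = k+1`-th order tensor `A`
with index set `ι`. -/
def tvec {ι : Type*} [Fintype ι] {k : ℕ} (A : (Fin (k + 1) → ι) → ℝ)
    (x : ι → ℝ) (i : ι) : ℝ :=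
  ∑ g : Fin k → ι, A (Fin.cons i g) * ∏ j, x (g j)

/-- `A` is a P-tensor. -/
def IsPTensor {ι : Type*} [Fintype ι] {k : ℕ} (A : (Fin (k + 1) → ι) → ℝ) : Prop :=
  ∀ x : ι → ℝ, x ≠ 0 → ∃ i, 0 < x i ^ k * tvec A x i

/-- Every H-eigenvalue of a P-tensor is positive. -/
theorem pTensor_hEigenvalue_pos {n k : ℕ} (A : (Fin (k + 1) → Fin n) → ℝ)
    (hA : IsPTensor A) (lam : ℝ) (x : Fin n → ℝ) (hx : x ≠ 0)
    (heig : ∀ i, tvec A x i = lam * x i ^ k) : 0 < lam := by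
  obtain ⟨i, hi⟩ := hA x hx
  rw [heig i, mul_left_comm] at hi
  exact pos_of_mul_pos_left hi (mul_self_nonneg _)
end

section
/- Let A be an m-th order n-dimensional real P₀-tensor. Then every H-eigenvalue of A is nonnegative; that is, if λ ∈ ℝ and x ∈ ℝⁿ is a nonzero vector with A x^{m-1} = λ x^{[m-1]}, then λ ≥ 0. -/
open Finset

/-- `A x^m`, the homogeneous form associated with `A`. -/
def tform {ι : Type*} [Fintype ι] {k : ℕ} (A : (Fin (k + 1) → ι) → ℝ)
    (x : ι → ℝ) : ℝ :=
  ∑ i, x i * tvec A x i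

/-- `A` is a P₀-tensor. -/
def IsP0Tensor {ι : Type*} [Fintype ι] {k : ℕ} (A : (Fin (k + 1) → ι) → ℝ) : Prop :=
  ∀ x : ι → ℝ, x ≠ 0 → ∃ i, x i ≠ 0 ∧ 0 ≤ x i ^ k * tvec A x i

/-- `A` is a symmetric tensor. -/
def IsSymmTensor {ι : Type*} {k : ℕ} (A : (Fin (k + 1) → ι) → ℝ) : Prop :=
  ∀ (σ : Equiv.Perm (Fin (k + 1))) (f : Fin (k + 1) → ι), A (f ∘ σ) = A f

/-- `A` is a completely positive tensor: a sum of `m`-th outer powers of nonnegative vectors. -/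
def IsCPTensor {n k : ℕ} (A : (Fin (k + 1) → Fin n) → ℝ) : Prop :=
  ∃ (r : ℕ) (u : Fin r → Fin n → ℝ), (∀ l i, 0 ≤ u l i) ∧
    ∀ f : Fin (k + 1) → Fin n, A f = ∑ l, ∏ t, u l (f t)

/-- `A` is a strongly completely positive tensor: a sum of `m`-th outer powers of nonnegative
vectors which span the whole space. -/
def IsSCPTensor {n k : ℕ} (A : (Fin (k + 1) → Fin n) → ℝ) : Prop :=
  ∃ (r : ℕ) (u : Fin r → Fin n → ℝ), (∀ l i, 0 ≤ u l i) ∧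
    (∀ f : Fin (k + 1) → Fin n, A f = ∑ l, ∏ t, u l (f t)) ∧
    Submodule.span ℝ (Set.range u) = ⊤

/-- Every H-eigenvalue of a P₀-tensor is nonnegative. -/
theorem p0Tensor_hEigenvalue_nonneg {n k : ℕ} (A : (Fin (k + 1) → Fin n) → ℝ)
    (hA : IsP0Tensor A) (lam : ℝ) (x : Fin n → ℝ) (hx : x ≠ 0)
    (heig : ∀ i, tvec A x i = lam * x i ^ k) : 0 ≤ lam := by
  obtain ⟨i, hi, h⟩ := hA x hx
  have hpos : 0 < x i ^ k * x i ^ k := mul_self_pos.mpr (pow_ne_zero k hi)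
  rw [heig i, mul_left_comm] at h
  exact nonneg_of_mul_nonneg_left h hpos
end

section
/- An m-th order n-dimensional real tensor A is a P-tensor if and only if for each nonzero vector x ∈ ℝⁿ there exists a diagonal n×n matrix D_x with all diagonal entries positive such that ⟨D_x x^{[m-1]}, A x^{m-1}⟩ > 0. -/
open Finset

/-- A finite real family has a positive member iff some positively weighted sum is positive. -/
theorem exists_pos_iff_exists_weighted_sum_pos {ι : Type*} [Fintype ι] [DecidableEq ι]
    (c : ι → ℝ) :
    (∃ i, 0 < c i) ↔ ∃ d : ι → ℝ, (∀ i, 0 < d i) ∧ 0 < ∑ i, d i * c i := by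
  constructor
  · rintro ⟨i₀, hi₀⟩
    have ht : 0 < (|∑ i, c i| + 1) / c i₀ := by positivity
    refine ⟨fun i => 1 + if i = i₀ then (|∑ i, c i| + 1) / c i₀ else 0, fun i => ?_, ?_⟩
    · dsimp only
      split_ifs <;> linarith
    · simp only [add_mul, one_mul, ite_mul, zero_mul, Finset.sum_add_distrib,
        Finset.sum_ite_eq', Finset.mem_univ, if_true]
      rw [div_mul_cancel₀ _ hi₀.ne']
      linarith [neg_abs_le (∑ i, c i)]
  · rintro ⟨d, hd, hsum⟩
    obtain ⟨i, -, hi⟩ := Finset.exists_lt_of_sum_lt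
      (show ∑ _i : ι, (0 : ℝ) < ∑ i, d i * c i by simpa using hsum)
    exact ⟨i, pos_of_mul_pos_right hi (hd i).le⟩

open Matrix in
/-- `A` is a P-tensor iff for each nonzero `x` there is a positive diagonal matrix `D` with
`⟨D x^[m-1], A x^{m-1}⟩ > 0`. -/
theorem pTensor_iff_diagonal {n k : ℕ} (A : (Fin (k + 1) → Fin n) → ℝ) :
    IsPTensor A ↔ ∀ x : Fin n → ℝ, x ≠ 0 →
      ∃ D : Matrix (Fin n) (Fin n) ℝ, D.IsDiag ∧ (∀ i, 0 < D i i) ∧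
        0 < D.mulVec (fun i => x i ^ k) ⬝ᵥ tvec A x := by
  refine forall₂_congr fun x _ => ?_
  rw [exists_pos_iff_exists_weighted_sum_pos]
  constructor
  · rintro ⟨d, hd, hsum⟩
    refine ⟨diagonal d, isDiag_diagonal d, by simpa using hd, ?_⟩
    simpa [dotProduct, mulVec_diagonal, mul_assoc] using hsum
  · rintro ⟨D, hD, hpos, hsum⟩
    refine ⟨D.diag, hpos, ?_⟩
    rw [← hD.diagonal_diag] at hsum
    simpa [dotProduct, mulVec_diagonal, mul_assoc] using hsum
end

section
/- Every completely positive tensor is a P₀-tensor; that is, if an m-th order n-dimensional real tensor A can be written as A = ∑_{k=1}^r u_k^{⊗m} where each u_k ∈ ℝⁿ has all components nonnegative, then A is a P₀-tensor. -/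
open Finset

/-- For a sum of outer powers of vectors `u l`, the vector `A x^{m-1}` is the combination of the
`u l` with coefficients `⟨u l, x⟩^{m-1}`. -/
theorem tvec_eq_sum_dotProduct_pow {ι κ : Type*} [Fintype ι] [Fintype κ] {k : ℕ}
    {A : (Fin (k + 1) → ι) → ℝ} {u : κ → ι → ℝ}
    (hA : ∀ f : Fin (k + 1) → ι, A f = ∑ l, ∏ t, u l (f t)) (x : ι → ℝ) (i : ι) :
    tvec A x i = ∑ l, u l i * (u l ⬝ᵥ x) ^ k := by
  simp only [tvec, hA, Fin.prod_univ_succ, Fin.cons_zero, Fin.cons_succ, sum_mul]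
  rw [sum_comm]
  refine sum_congr rfl fun l _ => ?_
  simp only [dotProduct, Fintype.sum_pow, mul_sum, prod_mul_distrib, mul_assoc]

/-- For a sum of outer powers of vectors `u l`, the form `A x^m` is the sum of the `⟨u l, x⟩^m`. -/
theorem tform_eq_sum_dotProduct_pow {ι κ : Type*} [Fintype ι] [Fintype κ] {k : ℕ}
    {A : (Fin (k + 1) → ι) → ℝ} {u : κ → ι → ℝ}
    (hA : ∀ f : Fin (k + 1) → ι, A f = ∑ l, ∏ t, u l (f t)) (x : ι → ℝ) :
    tform A x = ∑ l, (u l ⬝ᵥ x) ^ (k + 1) := by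
  simp only [tform, tvec_eq_sum_dotProduct_pow hA, mul_sum]
  rw [sum_comm]
  refine sum_congr rfl fun l _ => ?_
  rw [pow_succ', dotProduct, sum_mul]
  exact sum_congr rfl fun i _ => by ring

/-- A tensor of even order whose form is nonnegative is a P₀-tensor. -/
theorem isP0Tensor_of_tform_nonneg {ι : Type*} [Fintype ι] {k : ℕ} (hk : Odd k)
    {A : (Fin (k + 1) → ι) → ℝ} (hA : ∀ x, 0 ≤ tform A x) : IsP0Tensor A := by
  intro x hx
  obtain ⟨m, rfl⟩ := hk
  obtain ⟨i, hi⟩ := Function.ne_iff.mp hx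
  by_contra! h
  have hneg : ∀ j, x j ≠ 0 → x j * tvec A x j < 0 := fun j hj => by
    have := h j hj
    rw [pow_succ, mul_assoc] at this
    exact neg_of_mul_neg_right this ((even_two_mul m).pow_nonneg _)
  refine (hA x).not_gt (sum_neg' (fun j _ => ?_) ⟨i, mem_univ i, hneg i hi⟩)
  by_cases hj : x j = 0
  · simp [hj]
  · exact (hneg j hj).le

/-- A completely positive tensor is a P₀-tensor. -/
theorem cpTensor_isP0Tensor {n k : ℕ} (A : (Fin (k + 1) → Fin n) → ℝ)
    (hA : IsCPTensor A) : IsP0Tensor A := by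
  obtain ⟨r, u, hu, hAu⟩ := hA
  rcases Nat.even_or_odd k with hk | hk
  · intro x hx
    obtain ⟨i, hi⟩ := Function.ne_iff.mp hx
    refine ⟨i, hi, mul_nonneg (hk.pow_nonneg _) ?_⟩
    rw [tvec_eq_sum_dotProduct_pow hAu]
    exact sum_nonneg fun l _ => mul_nonneg (hu l i) (hk.pow_nonneg _)
  · refine isP0Tensor_of_tform_nonneg hk fun x => ?_
    rw [tform_eq_sum_dotProduct_pow hAu]
    exact sum_nonneg fun l _ => hk.add_one.pow_nonneg _
end

section
/- Every strongly completely positive tensor is a P-tensor; that is, if an m-th order n-dimensional real tensor A can be written as A = ∑_{k=1}^r u_k^{⊗m} where each u_k ∈ ℝⁿ has all components nonnegative and the vectors u_1,…,u_r span ℝⁿ, then A is a P-tensor. -/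
open Finset

/-- `A x^{m-1}` for a sum `A` of outer powers. -/
theorem tvec_eq_sum_mul_dotProduct_pow {ι κ : Type*} [Fintype ι] [Fintype κ] {k : ℕ}
    {A : (Fin (k + 1) → ι) → ℝ} {u : κ → ι → ℝ} (hA : ∀ f, A f = ∑ l, ∏ t, u l (f t))
    (x : ι → ℝ) (i : ι) : tvec A x i = ∑ l, u l i * (u l ⬝ᵥ x) ^ k := by
  simp only [tvec, hA, Fin.prod_univ_succ, Fin.cons_zero, Fin.cons_succ, dotProduct,
    Fintype.sum_pow, Finset.mul_sum, Finset.sum_mul, Finset.prod_mul_distrib]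
  rw [Finset.sum_comm]
  simp only [mul_assoc]

/-- A nonzero vector is not orthogonal to every member of a spanning family. -/
theorem exists_dotProduct_ne_zero_of_span_eq_top {ι κ : Type*} [Fintype ι] {u : κ → ι → ℝ}
    (hu : Submodule.span ℝ (Set.range u) = ⊤) {x : ι → ℝ} (hx : x ≠ 0) :
    ∃ l, u l ⬝ᵥ x ≠ 0 := by
  by_contra! h
  refine hx (dotProduct_self_eq_zero.1 ?_)
  have hmem : x ∈ Submodule.span ℝ (Set.range u) := hu ▸ Submodule.mem_top
  refine Submodule.span_induction (p := fun y _ => y ⬝ᵥ x = 0) ?_ ?_ ?_ ?_ hmem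
  · rintro _ ⟨l, rfl⟩
    exact h l
  · exact zero_dotProduct x
  · intro y z _ _ hy hz
    rw [add_dotProduct, hy, hz, add_zero]
  · intro a y _ hy
    rw [smul_dotProduct, hy, smul_zero]

/-- A strongly completely positive tensor is a P-tensor. -/
theorem scpTensor_isPTensor {n k : ℕ} (A : (Fin (k + 1) → Fin n) → ℝ)
    (hA : IsSCPTensor A) : IsPTensor A := by
  obtain ⟨r, u, hu, hAu, hspan⟩ := hA
  intro x hx
  obtain ⟨l, hl⟩ := exists_dotProduct_ne_zero_of_span_eq_top hspan hx
  simp only [tvec_eq_sum_mul_dotProduct_pow hAu]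
  rcases Nat.even_or_odd k with hk | hk
  · obtain ⟨i, -, hi⟩ := Finset.exists_ne_zero_of_sum_ne_zero hl
    refine ⟨i, mul_pos (hk.pow_pos (right_ne_zero_of_mul hi)) ?_⟩
    refine Finset.sum_pos' (fun l _ => mul_nonneg (hu l i) (hk.pow_nonneg _))
      ⟨l, Finset.mem_univ l, ?_⟩
    exact mul_pos ((hu l i).lt_of_ne' (left_ne_zero_of_mul hi)) (hk.pow_pos hl)
  · have hform : ∑ i, x i * ∑ l, u l i * (u l ⬝ᵥ x) ^ k = ∑ l, (u l ⬝ᵥ x) ^ (k + 1) := by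
      simp only [Finset.mul_sum]
      rw [Finset.sum_comm]
      refine Finset.sum_congr rfl fun l _ => ?_
      rw [pow_succ', dotProduct, Finset.sum_mul]
      exact Finset.sum_congr rfl fun i _ => by ring
    have hpos : 0 < ∑ i, x i * ∑ l, u l i * (u l ⬝ᵥ x) ^ k := by
      rw [hform]
      exact Finset.sum_pos' (fun l _ => hk.add_one.pow_nonneg _)
        ⟨l, Finset.mem_univ l, hk.add_one.pow_pos hl⟩
    obtain ⟨i, hi⟩ : ∃ i, 0 < x i * ∑ l, u l i * (u l ⬝ᵥ x) ^ k := by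
      by_contra! h
      exact hpos.not_ge (Finset.sum_nonpos fun i _ => h i)
    refine ⟨i, ?_⟩
    obtain ⟨j, rfl⟩ := hk
    rw [pow_succ, mul_assoc]
    exact mul_pos ((even_two_mul j).pow_pos (left_ne_zero_of_mul hi.ne')) hi
end

section
/- A strictly diagonally dominant tensor with all positive diagonal entries is a P-tensor; that is, if A is an m-th order n-dimensional real tensor such that a_{i i … i} > 0 and a_{i i … i} > ∑_{(i₂,…,i_m) ≠ (i,…,i)} |a_{i i₂ … i_m}| for every i = 1,…,n, then A is a P-tensor. -/
open Finset

/-- If `|x i|` is maximal among the coordinates of `x`, then each off-diagonal term of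
`x i ^ k * tvec A x i` is bounded below by `-|A (i, g)| * (x i ^ k) ^ 2`. -/
theorem neg_abs_mul_sq_le_of_abs_le {ι : Type*} {k : ℕ} (x : ι → ℝ) (i : ι)
    (hi : ∀ j, |x j| ≤ |x i|) (a : ℝ) (g : Fin k → ι) :
    -(|a| * (x i ^ k) ^ 2) ≤ x i ^ k * (a * ∏ j, x (g j)) := by
  have hprod : |∏ j, x (g j)| ≤ |x i| ^ k := by
    rw [Finset.abs_prod]
    simpa using Finset.prod_le_prod (s := Finset.univ) (fun j _ => abs_nonneg (x (g j)))
      (fun j _ => hi (g j))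
  refine neg_le_of_abs_le ?_
  calc |x i ^ k * (a * ∏ j, x (g j))| = |a| * (|x i| ^ k * |∏ j, x (g j)|) := by
        rw [abs_mul, abs_mul, abs_pow]; ring
    _ ≤ |a| * (|x i| ^ k * |x i| ^ k) := by gcongr
    _ = |a| * (x i ^ k) ^ 2 := by rw [← abs_pow, abs_mul_abs_self, sq]

/-- A strictly diagonally dominant tensor with positive diagonal entries is a P-tensor. -/
theorem strictlyDiagDominant_isPTensor {n k : ℕ} (A : (Fin (k + 1) → Fin n) → ℝ)
    (hdiag : ∀ i : Fin n, 0 < A (fun _ => i))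
    (hdom : ∀ i : Fin n,
      (∑ g ∈ Finset.univ.filter (fun g : Fin k → Fin n => g ≠ fun _ => i),
        |A (Fin.cons i g)|) < A (fun _ => i)) :
    IsPTensor A := by
  intro x hx
  obtain ⟨l, hl⟩ := Function.ne_iff.mp hx
  obtain ⟨i, -, hi⟩ := Finset.exists_max_image Finset.univ (fun j => |x j|) ⟨l, mem_univ l⟩
  replace hi : ∀ j, |x j| ≤ |x i| := fun j => hi j (mem_univ j)
  have hxi : x i ≠ 0 := abs_pos.mp ((abs_pos.mpr hl).trans_le (hi l))
  have hsq : 0 < (x i ^ k) ^ 2 := by positivity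
  have hcons : (Fin.cons i (fun _ => i) : Fin (k + 1) → Fin n) = fun _ => i := by
    ext t
    refine Fin.cases ?_ (fun _ => ?_) t <;> simp
  refine ⟨i, ?_⟩
  have hoff := Finset.sum_le_sum
    (s := Finset.univ.filter (fun g : Fin k → Fin n => g ≠ fun _ => i))
    (fun g _ => neg_abs_mul_sq_le_of_abs_le x i hi (A (Fin.cons i g)) g)
  rw [Finset.sum_neg_distrib, ← Finset.sum_mul] at hoff
  rw [tvec, Finset.mul_sum,
    ← Finset.add_sum_erase _ _ (Finset.mem_univ (fun _ => i : Fin k → Fin n)),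
    ← Finset.filter_ne', hcons]
  simp only [Finset.prod_const, Finset.card_univ, Fintype.card_fin]
  nlinarith [mul_lt_mul_of_pos_right (hdom i) hsq]
end

section
/- A diagonally dominant tensor with all nonnegative diagonal entries is a P₀-tensor; that is, if A is an m-th order n-dimensional real tensor such that a_{i i … i} ≥ 0 and a_{i i … i} ≥ ∑_{(i₂,…,i_m) ≠ (i,…,i)} |a_{i i₂ … i_m}| for every i = 1,…,n, then A is a P₀-tensor. -/
open Finset

/-- A diagonally dominant tensor with nonnegative diagonal entries is a P₀-tensor. -/
theorem diagDominant_isP0Tensor {n k : ℕ} (A : (Fin (k + 1) → Fin n) → ℝ)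
    (hdiag : ∀ i : Fin n, 0 ≤ A (fun _ => i))
    (hdom : ∀ i : Fin n,
      (∑ g ∈ Finset.univ.filter (fun g : Fin k → Fin n => g ≠ fun _ => i),
        |A (Fin.cons i g)|) ≤ A (fun _ => i)) :
    IsP0Tensor A := by
  intro x hx
  obtain ⟨j, hj⟩ := Function.ne_iff.mp hx
  obtain ⟨i, -, hi⟩ := exists_max_image univ (fun i => |x i|) ⟨j, mem_univ j⟩
  have hxi : x i ≠ 0 := abs_pos.mp ((abs_pos.mpr hj).trans_le (hi j (mem_univ j)))
  refine ⟨i, hxi, ?_⟩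
  have hbound (g : Fin k → Fin n) : |x i ^ k * ∏ j, x (g j)| ≤ (x i ^ k) ^ 2 := by
    have hprod : ∏ j, |x (g j)| ≤ |x i| ^ k := by
      simpa using prod_le_prod (s := univ) (fun j _ => abs_nonneg (x (g j)))
        (fun j _ => hi (g j) (mem_univ _))
    calc |x i ^ k * ∏ j, x (g j)| = |x i| ^ k * ∏ j, |x (g j)| := by
          rw [abs_mul, abs_pow, abs_prod]
      _ ≤ |x i| ^ k * |x i| ^ k := by gcongr
      _ = (x i ^ k) ^ 2 := by rw [← abs_pow, abs_mul_abs_self, sq]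
  have hcons : (Fin.cons i (fun _ => i) : Fin (k + 1) → Fin n) = fun _ => i := by
    ext t
    refine Fin.cases ?_ (fun _ => ?_) t <;> simp
  have hsplit : x i ^ k * tvec A x i = A (fun _ => i) * (x i ^ k) ^ 2 +
      ∑ g ∈ univ.filter (fun g : Fin k → Fin n => g ≠ fun _ => i),
        A (Fin.cons i g) * (x i ^ k * ∏ j, x (g j)) := by
    rw [tvec, mul_sum, ← add_sum_erase univ _ (mem_univ fun _ => i), hcons, filter_ne']
    congr 1
    · simp only [prod_const, card_univ, Fintype.card_fin]
      ring
    · exact sum_congr rfl fun g _ => mul_left_comm _ _ _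
  have hoff : -(A (fun _ => i) * (x i ^ k) ^ 2) ≤
      ∑ g ∈ univ.filter (fun g : Fin k → Fin n => g ≠ fun _ => i),
        A (Fin.cons i g) * (x i ^ k * ∏ j, x (g j)) := by
    refine (neg_le_neg (mul_le_mul_of_nonneg_right (hdom i) (sq_nonneg _))).trans ?_
    rw [sum_mul, ← sum_neg_distrib]
    refine sum_le_sum fun g _ => (neg_le_neg ?_).trans (neg_abs_le _)
    rw [abs_mul]
    exact mul_le_mul_of_nonneg_left (hbound g) (abs_nonneg _)
  linarith
end

section
/- Let u ∈ ℝⁿ have all components positive and let C be the m-th order n-dimensional Cauchy tensor generated by u, i.e., c_{i₁ i₂ … i_m} = 1/(u_{i₁} + u_{i₂} + ⋯ + u_{i_m}). Then C is a P₀-tensor. If in addition the components u₁,…,u_n are mutually distinct, then C is a P-tensor. -/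
open Finset

/-- The exponential sum `∑ j, x j * exp (-u j * s)`. -/
noncomputable def expSum {ι : Type*} [Fintype ι] (u x : ι → ℝ) (s : ℝ) : ℝ :=
  ∑ j, x j * Real.exp (-u j * s)

theorem continuous_expSum {ι : Type*} [Fintype ι] (u x : ι → ℝ) : Continuous (expSum u x) := by
  unfold expSum
  fun_prop

theorem expSum_pow {ι : Type*} [Fintype ι] (u x : ι → ℝ) (k : ℕ) (s : ℝ) :
    expSum u x s ^ k =
      ∑ g : Fin k → ι, (∏ j, x (g j)) * Real.exp (-(∑ j, u (g j)) * s) := by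
  rw [expSum, Fintype.sum_pow]
  refine Finset.sum_congr rfl fun g _ => ?_
  rw [Finset.prod_mul_distrib, ← Real.exp_sum, ← Finset.sum_mul, Finset.sum_neg_distrib]

theorem expSum_pow_succ {ι : Type*} [Fintype ι] (u x : ι → ℝ) (k : ℕ) (s : ℝ) :
    expSum u x s ^ (k + 1) = ∑ i, x i * (Real.exp (-u i * s) * expSum u x s ^ k) := by
  rw [pow_succ', expSum, Finset.sum_mul]
  simp only [mul_assoc]

theorem exists_expSum_ne_zero {n : ℕ} {u x : Fin n → ℝ} (hu : Function.Injective u) (hx : x ≠ 0) :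
    ∃ s, 0 < s ∧ expSum u x s ≠ 0 := by
  by_contra! h
  have hv : (fun j => x j * Real.exp (-u j)) = 0 := by
    refine Matrix.eq_zero_of_forall_pow_sum_mul_pow_eq_zero (f := fun j => Real.exp (-u j))
      (fun a b hab => hu (neg_injective (Real.exp_injective hab))) fun i => ?_
    rw [← h ((i : ℝ) + 1) (by positivity), expSum]
    refine Finset.sum_congr rfl fun j _ => ?_
    rw [← Real.exp_nat_mul, mul_assoc, ← Real.exp_add]
    ring_nf
  refine hx (funext fun j => ?_)
  simpa using congrFun hv j

theorem exp_mul_expSum_pow {ι : Type*} [Fintype ι] (u x : ι → ℝ) (k : ℕ) (i : ι) (s : ℝ) :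
    Real.exp (-u i * s) * expSum u x s ^ k =
      ∑ g : Fin k → ι, (∏ j, x (g j)) * Real.exp (-(u i + ∑ j, u (g j)) * s) := by
  rw [expSum_pow, Finset.mul_sum]
  refine Finset.sum_congr rfl fun g _ => ?_
  rw [mul_left_comm, ← Real.exp_add]
  ring_nf

theorem integrableOn_exp_mul_expSum_pow {ι : Type*} [Fintype ι] {u : ι → ℝ} (hu : ∀ i, 0 < u i)
    (x : ι → ℝ) (k : ℕ) (i : ι) :
    MeasureTheory.IntegrableOn (fun s => Real.exp (-u i * s) * expSum u x s ^ k) (Set.Ioi 0) := by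
  simp only [exp_mul_expSum_pow]
  refine MeasureTheory.integrable_finsetSum _ fun g _ => MeasureTheory.Integrable.const_mul ?_ _
  exact exp_neg_integrableOn_Ioi 0
    (add_pos_of_pos_of_nonneg (hu i) (Finset.sum_nonneg fun j _ => (hu (g j)).le))

theorem tvec_cauchy_eq_integral {ι : Type*} [Fintype ι] {u : ι → ℝ} (hu : ∀ i, 0 < u i)
    (x : ι → ℝ) (k : ℕ) (i : ι) :
    tvec (fun f : Fin (k + 1) → ι => 1 / ∑ t, u (f t)) x i =
      ∫ s in Set.Ioi 0, Real.exp (-u i * s) * expSum u x s ^ k := by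
  have hpos (g : Fin k → ι) : 0 < u i + ∑ j, u (g j) :=
    add_pos_of_pos_of_nonneg (hu i) (Finset.sum_nonneg fun j _ => (hu (g j)).le)
  simp only [exp_mul_expSum_pow]
  rw [MeasureTheory.integral_finsetSum _ fun g _ =>
    (exp_neg_integrableOn_Ioi 0 (hpos g)).const_mul _]
  refine Finset.sum_congr rfl fun g _ => ?_
  rw [MeasureTheory.integral_const_mul, integral_exp_mul_Ioi (neg_lt_zero.2 (hpos g)),
    mul_zero, Real.exp_zero, neg_div_neg_eq, mul_comm]
  simp [Fin.sum_univ_succ]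

theorem integrableOn_expSum_pow_succ {ι : Type*} [Fintype ι] {u : ι → ℝ} (hu : ∀ i, 0 < u i)
    (x : ι → ℝ) (k : ℕ) :
    MeasureTheory.IntegrableOn (fun s => expSum u x s ^ (k + 1)) (Set.Ioi 0) := by
  simp only [expSum_pow_succ]
  exact MeasureTheory.integrable_finsetSum _ fun i _ =>
    (integrableOn_exp_mul_expSum_pow hu x k i).const_mul _

theorem tform_cauchy_eq_integral {ι : Type*} [Fintype ι] {u : ι → ℝ} (hu : ∀ i, 0 < u i)
    (x : ι → ℝ) (k : ℕ) :
    tform (fun f : Fin (k + 1) → ι => 1 / ∑ t, u (f t)) x =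
      ∫ s in Set.Ioi 0, expSum u x s ^ (k + 1) := by
  simp only [expSum_pow_succ]
  rw [MeasureTheory.integral_finsetSum _ fun i _ =>
    (integrableOn_exp_mul_expSum_pow hu x k i).const_mul _]
  refine Finset.sum_congr rfl fun i _ => ?_
  rw [MeasureTheory.integral_const_mul, tvec_cauchy_eq_integral hu]

theorem setIntegral_Ioi_pos_of_continuous {f : ℝ → ℝ} (hf : Continuous f) (h0 : ∀ s, 0 ≤ f s)
    (hi : MeasureTheory.IntegrableOn f (Set.Ioi 0)) {s : ℝ} (hs : 0 < s) (hfs : f s ≠ 0) :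
    0 < ∫ t in Set.Ioi 0, f t := by
  rw [MeasureTheory.setIntegral_pos_iff_support_of_nonneg_ae
    (Filter.Eventually.of_forall h0) hi]
  exact (hf.isOpen_support.inter isOpen_Ioi).measure_pos _ ⟨s, hfs, hs⟩

theorem Odd.pow_mul_pos_of_mul_pos {k : ℕ} (hk : Odd k) {a b : ℝ} (h : 0 < a * b) :
    0 < a ^ k * b := by
  obtain ⟨l, rfl⟩ := hk
  have ha : a ≠ 0 := left_ne_zero_of_mul h.ne'
  rw [pow_succ, mul_assoc]
  exact mul_pos ((even_two_mul l).pow_pos ha) h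

theorem Odd.pow_mul_nonneg_of_mul_nonneg {k : ℕ} (hk : Odd k) {a b : ℝ} (h : 0 ≤ a * b) :
    0 ≤ a ^ k * b := by
  obtain ⟨l, rfl⟩ := hk
  rw [pow_succ, mul_assoc]
  exact mul_nonneg ((even_two_mul l).pow_nonneg a) h

/-- The Cauchy tensor generated by a positive vector is a P₀-tensor; it is a P-tensor when the
entries of the generating vector are mutually distinct. -/
theorem cauchyTensor_p0_and_p {n k : ℕ} (u : Fin n → ℝ) (hu : ∀ i, 0 < u i) :
    IsP0Tensor (fun f : Fin (k + 1) → Fin n => 1 / ∑ t, u (f t)) ∧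
    (Function.Injective u →
      IsPTensor (fun f : Fin (k + 1) → Fin n => 1 / ∑ t, u (f t))) := by
  refine ⟨fun x hx => ?_, fun hinj x hx => ?_⟩
  · obtain ⟨i, hi⟩ := Function.ne_iff.1 hx
    rcases k.even_or_odd with hk | hk
    · refine ⟨i, hi, mul_nonneg (hk.pow_nonneg _) ?_⟩
      rw [tvec_cauchy_eq_integral hu]
      exact MeasureTheory.integral_nonneg fun s =>
        mul_nonneg (Real.exp_pos _).le (hk.pow_nonneg _)
    · have hform : 0 ≤ tform (fun f : Fin (k + 1) → Fin n => 1 / ∑ t, u (f t)) x := by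
        rw [tform_cauchy_eq_integral hu]
        exact MeasureTheory.integral_nonneg fun s => hk.add_one.pow_nonneg _
      by_contra! h
      have hneg (j : Fin n) (hj : x j ≠ 0) :
          x j * tvec (fun f : Fin (k + 1) → Fin n => 1 / ∑ t, u (f t)) x j < 0 := by
        by_contra! h'
        exact (h j hj).not_ge (hk.pow_mul_nonneg_of_mul_nonneg h')
      refine hform.not_gt (Finset.sum_neg' (fun j _ => ?_) ⟨i, Finset.mem_univ i, hneg i hi⟩)
      by_cases hj : x j = 0
      · simp [hj]
      · exact (hneg j hj).le
  · obtain ⟨s, hs, hqs⟩ := exists_expSum_ne_zero hinj hx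
    have hcont := continuous_expSum u x
    rcases k.even_or_odd with hk | hk
    · obtain ⟨i, hi⟩ := Function.ne_iff.1 hx
      refine ⟨i, mul_pos (hk.pow_pos hi) ?_⟩
      rw [tvec_cauchy_eq_integral hu]
      exact setIntegral_Ioi_pos_of_continuous (by fun_prop)
        (fun s => mul_nonneg (Real.exp_pos _).le (hk.pow_nonneg _))
        (integrableOn_exp_mul_expSum_pow hu x k i) hs
        (mul_ne_zero (Real.exp_ne_zero _) (pow_ne_zero _ hqs))
    · have hform : 0 < tform (fun f : Fin (k + 1) → Fin n => 1 / ∑ t, u (f t)) x := by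
        rw [tform_cauchy_eq_integral hu]
        exact setIntegral_Ioi_pos_of_continuous (by fun_prop) (fun s => hk.add_one.pow_nonneg _)
          (integrableOn_expSum_pow_succ hu x k) hs (pow_ne_zero _ hqs)
      rw [tform, ← Finset.sum_const_zero (s := (Finset.univ : Finset (Fin n)))] at hform
      obtain ⟨i, -, hi⟩ := Finset.exists_lt_of_sum_lt hform
      exact ⟨i, hk.pow_mul_pos_of_mul_pos hi⟩
end

section
/- Let m be odd and let A and C be m-th order n-dimensional real tensors, where C is completely positive. If A is a P-tensor then A + C is a P-tensor, and if A is a P₀-tensor then A + C is a P₀-tensor. In particular, the sum of an odd-order P-tensor (resp. P₀-tensor) and a diagonal tensor with nonnegative diagonal entries is a P-tensor (resp. P₀-tensor). -/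
open Finset

theorem tvec_add {ι : Type*} [Fintype ι] {k : ℕ} (A C : (Fin (k + 1) → ι) → ℝ)
    (x : ι → ℝ) (i : ι) : tvec (A + C) x i = tvec A x i + tvec C x i := by
  simp only [tvec, Pi.add_apply, add_mul, Finset.sum_add_distrib]

theorem IsPTensor.add_of_tvec_nonneg {ι : Type*} [Fintype ι] {k : ℕ} (hk : Even k)
    {A C : (Fin (k + 1) → ι) → ℝ} (hA : IsPTensor A) (hC : ∀ x i, 0 ≤ tvec C x i) :
    IsPTensor (A + C) := by
  intro x hx
  obtain ⟨i, hi⟩ := hA x hx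
  refine ⟨i, ?_⟩
  rw [tvec_add, mul_add]
  exact add_pos_of_pos_of_nonneg hi (mul_nonneg (hk.pow_nonneg _) (hC x i))

theorem IsP0Tensor.add_of_tvec_nonneg {ι : Type*} [Fintype ι] {k : ℕ} (hk : Even k)
    {A C : (Fin (k + 1) → ι) → ℝ} (hA : IsP0Tensor A) (hC : ∀ x i, 0 ≤ tvec C x i) :
    IsP0Tensor (A + C) := by
  intro x hx
  obtain ⟨i, hxi, hi⟩ := hA x hx
  refine ⟨i, hxi, ?_⟩
  rw [tvec_add, mul_add]
  exact add_nonneg hi (mul_nonneg (hk.pow_nonneg _) (hC x i))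

theorem IsCPTensor.tvec_nonneg {n k : ℕ} (hk : Even k) {C : (Fin (k + 1) → Fin n) → ℝ}
    (hC : IsCPTensor C) (x : Fin n → ℝ) (i : Fin n) : 0 ≤ tvec C x i := by
  obtain ⟨r, u, hu, hCu⟩ := hC
  have h : tvec C x i = ∑ l, u l i * (∑ a, u l a * x a) ^ k := by
    simp only [tvec, hCu, Fin.prod_univ_succ, Fin.cons_zero, Fin.cons_succ, Finset.sum_mul]
    rw [Finset.sum_comm]
    simp only [Fintype.sum_pow, Finset.mul_sum, Finset.prod_mul_distrib, mul_assoc]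
  rw [h]
  exact Finset.sum_nonneg fun l _ => mul_nonneg (hu l i) (hk.pow_nonneg _)

theorem tvec_nonneg_of_diagonal {ι : Type*} [Fintype ι] {k : ℕ} (hk : Even k)
    {D : (Fin (k + 1) → ι) → ℝ}
    (hoff : ∀ f : Fin (k + 1) → ι, (¬ ∃ i, f = fun _ => i) → D f = 0)
    (hdiag : ∀ i, 0 ≤ D (fun _ => i)) (x : ι → ℝ) (i : ι) : 0 ≤ tvec D x i := by
  refine Finset.sum_nonneg fun g _ => ?_
  by_cases h : ∃ a, (Fin.cons i g : Fin (k + 1) → ι) = fun _ => a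
  · obtain ⟨a, ha⟩ := h
    have hg : ∀ j, g j = a := fun j => by simpa using congrFun ha j.succ
    rw [ha]
    refine mul_nonneg (hdiag a) ?_
    simpa [hg] using hk.pow_nonneg (x a)
  · rw [hoff _ h, zero_mul]

/-- For odd order `m = k + 1`, adding a completely positive tensor preserves the P-
(P₀-) tensor property; in particular so does adding a nonnegative diagonal tensor. -/
theorem odd_pTensor_add_cp {n k : ℕ} (hodd : Odd (k + 1))
    (A C : (Fin (k + 1) → Fin n) → ℝ) (hC : IsCPTensor C) :
    ((IsPTensor A → IsPTensor (A + C)) ∧ (IsP0Tensor A → IsP0Tensor (A + C))) ∧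
    (∀ D : (Fin (k + 1) → Fin n) → ℝ,
      (∀ f : Fin (k + 1) → Fin n, (¬ ∃ i, f = fun _ => i) → D f = 0) →
      (∀ i : Fin n, 0 ≤ D (fun _ => i)) →
      (IsPTensor A → IsPTensor (A + D)) ∧ (IsP0Tensor A → IsP0Tensor (A + D))) := by
  have hk : Even k := by grind
  exact ⟨⟨fun hA => hA.add_of_tvec_nonneg hk (hC.tvec_nonneg hk),
      fun hA => hA.add_of_tvec_nonneg hk (hC.tvec_nonneg hk)⟩,
    fun D hoff hdiag => ⟨fun hA => hA.add_of_tvec_nonneg hk (tvec_nonneg_of_diagonal hk hoff hdiag),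
      fun hA => hA.add_of_tvec_nonneg hk (tvec_nonneg_of_diagonal hk hoff hdiag)⟩⟩
end

section
/- Let m be odd. Every m-th order n-dimensional B-tensor is a P-tensor, and every m-th order n-dimensional B₀-tensor is a P₀-tensor. -/
open Finset

lemma sum_prod_eq_sum_pow {ι : Type*} [Fintype ι] (k : ℕ) (x : ι → ℝ) :
    ∑ g : Fin k → ι, ∏ j, x (g j) = (∑ i, x i) ^ k := by
  classical
  simpa using (Finset.prod_univ_sum (fun _ : Fin k => (Finset.univ : Finset ι))
    (fun _ i => x i)).symm

/-- Decomposition of a component of `A x^{m-1}` around the mean `b` of the corresponding row. -/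
lemma tvec_eq_mean_mul_add {ι : Type*} [Fintype ι] {k : ℕ} (A : (Fin (k + 1) → ι) → ℝ)
    (x : ι → ℝ) (i : ι) (b : ℝ)
    (hb : (Fintype.card ι : ℝ) ^ k * b = ∑ g : Fin k → ι, A (Fin.cons i g)) :
    tvec A x i = b * (∑ j, x j) ^ k +
      ∑ g : Fin k → ι, (b - A (Fin.cons i g)) * (x i ^ k - ∏ j, x (g j)) := by
  classical
  have hcard : ∑ _g : Fin k → ι, b = (Fintype.card ι : ℝ) ^ k * b := by simp
  simp only [tvec, mul_sub, sub_mul, Finset.sum_sub_distrib]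
  rw [← Finset.sum_mul, ← Finset.sum_mul, ← Finset.mul_sum, sum_prod_eq_sum_pow, hcard, hb]
  ring

lemma prod_le_pow_of_abs_le {ι : Type*} {k : ℕ} (hk : Even k) (x : ι → ℝ) (i : ι)
    (hi : ∀ j, |x j| ≤ |x i|) (g : Fin k → ι) : ∏ j, x (g j) ≤ x i ^ k := by
  calc ∏ j, x (g j) ≤ |∏ j, x (g j)| := le_abs_self _
    _ = ∏ j, |x (g j)| := Finset.abs_prod _ _
    _ ≤ ∏ _j : Fin k, |x i| := Finset.prod_le_prod (fun _ _ => abs_nonneg _) fun j _ => hi (g j)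
    _ = x i ^ k := by simp [hk.pow_abs]

lemma exists_ne_zero_abs_le {ι : Type*} [Finite ι] {x : ι → ℝ} (hx : x ≠ 0) :
    ∃ i, x i ≠ 0 ∧ ∀ j, |x j| ≤ |x i| := by
  obtain ⟨l, hl⟩ := Function.ne_iff.mp hx
  have : Nonempty ι := ⟨l⟩
  obtain ⟨i, hi⟩ := Finite.exists_max fun j => |x j|
  exact ⟨i, abs_pos.mp ((abs_pos.mpr hl).trans_le (hi l)), hi⟩

/-- If the entries of `x` sum to zero, some product of `k` of them differs from `x i ^ k`. -/
lemma exists_prod_ne_pow {ι : Type*} [Fintype ι] {k : ℕ} (hk : k ≠ 0) {x : ι → ℝ} {i : ι}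
    (hi : x i ≠ 0) (hs : ∑ j, x j = 0) : ∃ g : Fin k → ι, ∏ j, x (g j) ≠ x i ^ k := by
  classical
  obtain ⟨l, rfl⟩ := Nat.exists_eq_succ_of_ne_zero hk
  have : Nonempty ι := ⟨i⟩
  obtain ⟨j, hj⟩ : ∃ j, x j ≠ x i := by
    by_contra! h
    simp [h, hi] at hs
  refine ⟨Fin.cons j fun _ => i, fun h => hj ?_⟩
  rw [Fin.prod_univ_succ] at h
  simp only [Fin.cons_zero, Fin.cons_succ, Finset.prod_const, Finset.card_univ,
    Fintype.card_fin, Nat.succ_eq_add_one, pow_succ'] at h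
  exact mul_right_cancel₀ (pow_ne_zero l hi) h

/-- An odd-order B-tensor is a P-tensor, and an odd-order B₀-tensor is a P₀-tensor. -/
theorem odd_bTensor_isPTensor {n k : ℕ} (hodd : Odd (k + 1))
    (A : (Fin (k + 1) → Fin n) → ℝ) :
    ((∀ i : Fin n, 0 < ∑ g : Fin k → Fin n, A (Fin.cons i g) ∧
        ∀ g : Fin k → Fin n, g ≠ (fun _ => i) →
          A (Fin.cons i g) < (1 / (n : ℝ) ^ k) * ∑ g' : Fin k → Fin n, A (Fin.cons i g')) →
      IsPTensor A) ∧
    ((∀ i : Fin n, 0 ≤ ∑ g : Fin k → Fin n, A (Fin.cons i g) ∧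
        ∀ g : Fin k → Fin n, g ≠ (fun _ => i) →
          A (Fin.cons i g) ≤ (1 / (n : ℝ) ^ k) * ∑ g' : Fin k → Fin n, A (Fin.cons i g')) →
      IsP0Tensor A) := by
  have hk : Even k := by
    by_contra h
    exact (Nat.not_even_iff_odd.mpr hodd) (Nat.not_even_iff_odd.mp h).add_one
  have hmean (i : Fin n) : (Fintype.card (Fin n) : ℝ) ^ k *
      ((1 / (n : ℝ) ^ k) * ∑ g : Fin k → Fin n, A (Fin.cons i g)) =
      ∑ g : Fin k → Fin n, A (Fin.cons i g) := by
    have : (n : ℝ) ≠ 0 := Nat.cast_ne_zero.mpr i.pos.ne'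
    rw [Fintype.card_fin]
    field_simp
  refine ⟨fun hA x hx => ?_, fun hA x hx => ?_⟩ <;>
    obtain ⟨i, hi0, hi⟩ := exists_ne_zero_abs_le hx <;>
    obtain ⟨hpos, hoff⟩ := hA i <;>
    have hn : 0 < 1 / (n : ℝ) ^ k := one_div_pos.mpr (pow_pos (Nat.cast_pos.mpr i.pos) k)
  · refine ⟨i, mul_pos (hk.pow_pos hi0) ?_⟩
    rw [tvec_eq_mean_mul_add A x i _ (hmean i)]
    have hterm (g : Fin k → Fin n) : 0 ≤ ((1 / (n : ℝ) ^ k) *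
        ∑ g' : Fin k → Fin n, A (Fin.cons i g') - A (Fin.cons i g)) *
        (x i ^ k - ∏ j, x (g j)) := by
      by_cases hg : g = fun _ => i
      · simp [hg]
      · exact mul_nonneg (sub_nonneg.mpr (hoff g hg).le)
          (sub_nonneg.mpr (prod_le_pow_of_abs_le hk x i hi g))
    by_cases hs : (∑ j, x j) ^ k = 0
    · have hk0 : k ≠ 0 := by
        rintro rfl
        simp at hs
      replace hs := pow_eq_zero_iff hk0 |>.mp hs
      obtain ⟨g, hg⟩ := exists_prod_ne_pow hk0 hi0 hs
      refine add_pos_of_nonneg_of_pos (mul_nonneg (mul_pos hn hpos).le (hk.pow_nonneg _))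
        (Finset.sum_pos' (fun g _ => hterm g) ⟨g, Finset.mem_univ g, mul_pos ?_ ?_⟩)
      · refine sub_pos.mpr (hoff g ?_)
        rintro rfl
        simp at hg
      · exact sub_pos.mpr ((prod_le_pow_of_abs_le hk x i hi g).lt_of_ne hg)
    · exact add_pos_of_pos_of_nonneg
        (mul_pos (mul_pos hn hpos) ((hk.pow_nonneg _).lt_of_ne' hs))
        (Finset.sum_nonneg fun g _ => hterm g)
  · refine ⟨i, hi0, mul_nonneg (hk.pow_nonneg _) ?_⟩
    rw [tvec_eq_mean_mul_add A x i _ (hmean i)]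
    refine add_nonneg (mul_nonneg (mul_nonneg hn.le hpos) (hk.pow_nonneg _))
      (Finset.sum_nonneg fun g _ => ?_)
    by_cases hg : g = fun _ => i
    · simp [hg]
    · exact mul_nonneg (sub_nonneg.mpr (hoff g hg))
        (sub_nonneg.mpr (prod_le_pow_of_abs_le hk x i hi g))
end

section
/- The convex hull of the set P₀(m,n) of m-th order n-dimensional P₀-tensors equals the convex cone generated by P₀(m,n), and both equal the set of all m-th order n-dimensional real tensors whose diagonal entries a_{i i … i}, i = 1,…,n, are all nonnegative. -/
open Finset

/-- A tensor with at most one nonzero entry is a P₀-tensor as soon as that entry is off the diagonal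
or nonnegative. -/
theorem isP0Tensor_single {ι : Type*} [Fintype ι] [DecidableEq ι] {k : ℕ}
    (f : Fin (k + 1) → ι) (c : ℝ) (hc : (∀ j, f j = f 0) → 0 ≤ c) :
    IsP0Tensor (Pi.single f c : (Fin (k + 1) → ι) → ℝ) := by
  intro x hx
  by_cases h : ∃ j, j ≠ f 0 ∧ x j ≠ 0
  · obtain ⟨j, hj, hxj⟩ := h
    refine ⟨j, hxj, ?_⟩
    have h0 : tvec (Pi.single f c : (Fin (k + 1) → ι) → ℝ) x j = 0 := by
      refine Finset.sum_eq_zero fun g _ => ?_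
      have hg : (Fin.cons j g : Fin (k + 1) → ι) ≠ f := fun e => hj (by simp [← e])
      rw [Pi.single_eq_of_ne hg, zero_mul]
    simp [h0]
  · push Not at h
    have hx0 : x (f 0) ≠ 0 := fun h0 => hx <| funext fun j => by
      by_cases hj : j = f 0
      · rw [hj, h0, Pi.zero_apply]
      · exact h j hj
    refine ⟨f 0, hx0, ?_⟩
    rw [tvec, Finset.mul_sum]
    refine Finset.sum_nonneg fun g _ => ?_
    by_cases hg : (Fin.cons (f 0) g : Fin (k + 1) → ι) = f
    · have hgs (j : Fin k) : g j = f j.succ := by rw [← hg, Fin.cons_succ]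
      rw [hg, Pi.single_eq_same]
      by_cases hf : ∀ j, f j = f 0
      · simp only [hgs, hf, Finset.prod_const, Finset.card_univ, Fintype.card_fin]
        rw [mul_left_comm]
        exact mul_nonneg (hc hf) (mul_self_nonneg _)
      · push Not at hf
        obtain ⟨j, hj⟩ := hf
        obtain ⟨l, rfl⟩ := Fin.exists_succ_eq.2 (fun e : j = 0 => hj (by rw [e]))
        rw [Finset.prod_eq_zero (Finset.mem_univ l) (by rw [hgs]; exact h _ hj)]
        simp
    · rw [Pi.single_eq_of_ne hg]
      simp

/-- The diagonal entries of a P₀-tensor are nonnegative. -/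
theorem IsP0Tensor.diag_nonneg {ι : Type*} [Fintype ι] {k : ℕ}
    {A : (Fin (k + 1) → ι) → ℝ} (hA : IsP0Tensor A) (i : ι) : 0 ≤ A (fun _ => i) := by
  classical
  obtain ⟨j, hj, h⟩ := hA (Pi.single i 1) (by simp)
  obtain rfl : j = i := by
    by_contra hne
    exact hj (Pi.single_eq_of_ne hne 1)
  have ht : tvec A (Pi.single j 1) j = A (fun _ => j) := by
    rw [tvec, Finset.sum_eq_single (fun _ => j)]
    · have : (Fin.cons j (fun _ => j) : Fin (k + 1) → ι) = fun _ => j := by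
        ext l
        refine Fin.cases ?_ (fun _ => ?_) l <;> simp
      simp [this]
    · intro g _ hg
      obtain ⟨l, hl⟩ := Function.ne_iff.1 hg
      rw [Finset.prod_eq_zero (Finset.mem_univ l) (Pi.single_eq_of_ne hl 1), mul_zero]
    · simp
  simpa [ht] using h

/-- The convex hull of the set of P₀-tensors coincides with the convex cone it generates
(the span over nonnegative scalars), and both equal the set of tensors with nonnegative
diagonal entries. -/
theorem convexHull_p0_eq_cone_eq_nonnegDiag {n k : ℕ} :
    convexHull ℝ {A : (Fin (k + 1) → Fin n) → ℝ | IsP0Tensor A}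
      = {A : (Fin (k + 1) → Fin n) → ℝ | ∀ i : Fin n, 0 ≤ A (fun _ => i)} ∧
    ((Submodule.span {c : ℝ // 0 ≤ c}
        {A : (Fin (k + 1) → Fin n) → ℝ | IsP0Tensor A} :
        PointedCone ℝ ((Fin (k + 1) → Fin n) → ℝ)) :
        Set ((Fin (k + 1) → Fin n) → ℝ))
      = {A : (Fin (k + 1) → Fin n) → ℝ | ∀ i : Fin n, 0 ≤ A (fun _ => i)} := by
  have hsingle (A : (Fin (k + 1) → Fin n) → ℝ) (hA : ∀ i, 0 ≤ A (fun _ => i))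
      (r : ℝ) (hr : 0 ≤ r) (f : Fin (k + 1) → Fin n) :
      IsP0Tensor (Pi.single f (r * A f) : (Fin (k + 1) → Fin n) → ℝ) :=
    isP0Tensor_single f _ fun hf => mul_nonneg hr <| by
      rw [show f = fun _ => f 0 from funext hf]
      exact hA _
  refine ⟨Set.Subset.antisymm (convexHull_min (fun A hA => hA.diag_nonneg) ?_) ?_,
    Set.Subset.antisymm ?_ ?_⟩
  · intro A hA B hB a b ha hb _ i
    exact add_nonneg (mul_nonneg ha (hA i)) (mul_nonneg hb (hB i))
  · intro A hA
    rcases isEmpty_or_nonempty (Fin (k + 1) → Fin n) with hI | hI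
    · refine subset_convexHull ℝ _ fun x hx => (hx ?_).elim
      exact funext fun i => (hI.false fun _ => i).elim
    · set N : ℝ := ((Fintype.card (Fin (k + 1) → Fin n) : ℕ) : ℝ) with hN
      have hN0 : 0 < N := by
        rw [hN]
        exact_mod_cast Fintype.card_pos
      have hsum : ∑ f, N⁻¹ • (Pi.single f (N * A f) : (Fin (k + 1) → Fin n) → ℝ) = A := by
        rw [← Finset.univ_sum_single A]
        refine Finset.sum_congr rfl fun f _ => ?_
        rw [← Pi.single_smul, Finset.univ_sum_single A, smul_eq_mul,
          inv_mul_cancel_left₀ hN0.ne']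
      rw [← hsum]
      refine (convex_convexHull ℝ _).sum_mem (fun _ _ => inv_nonneg.2 hN0.le) ?_
        fun f _ => subset_convexHull ℝ _ (hsingle A hA N hN0.le f)
      rw [Finset.sum_const, Finset.card_univ, nsmul_eq_mul, ← hN, mul_inv_cancel₀ hN0.ne']
  · intro A hA
    induction hA using Submodule.span_induction with
    | mem A hA => exact hA.diag_nonneg
    | zero => exact fun _ => le_rfl
    | add A B _ _ hA hB => exact fun i => add_nonneg (hA i) (hB i)
    | smul c A _ hA => exact fun i => mul_nonneg c.2 (hA i)
  · intro A hA
    rw [← Finset.univ_sum_single A]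
    refine Submodule.sum_mem _ fun f _ => Submodule.subset_span ?_
    simpa using hsingle A hA 1 zero_le_one f
end
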